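/- arXiv:2206.12359 — 6 statements merged into one kernel-verified Lean document; each statement's English description precedes it below -/
import Mathlib

section
/- Let m > n > 0, set D₁ = ((m−n)/(1+m))·((1+m)/(1+n))^{(1+n)/(m−n)}, and let 0 < ε ≤ 1. Then for all reals h₁, h₂ ≥ 0 one has h₁^{1+m} + h₂^{1+n} ≥ 2^{−(1+n)}·ε·(h₁ + h₂)^{1+n} − D₁·ε^{(1+m)/(m−n)}. -/
/-- Young's inequality for `ε * x ^ a` with conjugate exponents `b / a` and `b / (b - a)`. -/
theorem mul_rpow_le_rpow_add {a b ε x : ℝ} (ha : 0 < a) (hab : a < b) (hε : 0 ≤ ε) (hx : 0 ≤ x) :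
    ε * x ^ a ≤ x ^ b + (b - a) / b * ε ^ (b / (b - a)) := by
  have hb : 0 < b := ha.trans hab
  have hba : 0 < b - a := sub_pos.2 hab
  have hpq : (b / a).HolderConjugate (b / (b - a)) := by
    rw [Real.holderConjugate_iff]
    refine ⟨(one_lt_div ha).2 hab, ?_⟩
    field_simp
    ring
  have young := Real.young_inequality_of_nonneg (Real.rpow_nonneg hx a) hε hpq
  rw [← Real.rpow_mul hx, mul_div_cancel₀ b ha.ne'] at young
  have hle : x ^ b / (b / a) ≤ x ^ b :=
    div_le_self (Real.rpow_nonneg hx b) ((one_le_div ha).2 hab.le)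
  have heq : ε ^ (b / (b - a)) / (b / (b - a)) = (b - a) / b * ε ^ (b / (b - a)) := by
    field_simp
  linarith

theorem two_rpow_neg_mul_add_rpow_le {a x y : ℝ} (ha : 0 ≤ a) (hx : 0 ≤ x) (hy : 0 ≤ y) :
    (2 : ℝ) ^ (-a) * (x + y) ^ a ≤ x ^ a + y ^ a := by
  have heq : (2 : ℝ) ^ (-a) * (x + y) ^ a = ((x + y) / 2) ^ a := by
    rw [Real.div_rpow (add_nonneg hx hy) zero_le_two, Real.rpow_neg zero_le_two]
    ring
  rw [heq]
  have hxa := Real.rpow_nonneg hx a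
  have hya := Real.rpow_nonneg hy a
  rcases le_total x y with h | h
  · have := Real.rpow_le_rpow (by positivity) (by linarith : (x + y) / 2 ≤ y) ha
    linarith
  · have := Real.rpow_le_rpow (by positivity) (by linarith : (x + y) / 2 ≤ x) ha
    linarith



/-- Combined estimate from the proof of Theorem 4.1 (Case 3): for `m > n > 0`,
`D₁ = ((m-n)/(1+m))·((1+m)/(1+n))^((1+n)/(m-n))`, `0 < ε ≤ 1` and `h₁, h₂ ≥ 0`,
`h₁^(1+m) + h₂^(1+n) ≥ 2^(−(1+n))·ε·(h₁+h₂)^(1+n) − D₁·ε^((1+m)/(m-n))`. -/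
theorem stmt_2 (m n : ℝ) (hn : 0 < n) (hmn : n < m)
    (D₁ : ℝ) (hD₁ : D₁ = ((m - n) / (1 + m)) * ((1 + m) / (1 + n)) ^ ((1 + n) / (m - n)))
    (ε : ℝ) (hε0 : 0 < ε) (hε1 : ε ≤ 1)
    (h₁ h₂ : ℝ) (hh₁ : 0 ≤ h₁) (hh₂ : 0 ≤ h₂) :
    (2 : ℝ) ^ (-(1 + n)) * ε * (h₁ + h₂) ^ (1 + n) - D₁ * ε ^ ((1 + m) / (m - n))
      ≤ h₁ ^ (1 + m) + h₂ ^ (1 + n) := by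
  have hm : 0 < m - n := sub_pos.2 hmn
  have young := mul_rpow_le_rpow_add (a := 1 + n) (b := 1 + m) (by linarith) (by linarith)
    hε0.le hh₁
  rw [add_sub_add_left_eq_sub] at young
  have hD : (m - n) / (1 + m) ≤ D₁ := by
    rw [hD₁]
    refine le_mul_of_one_le_right (div_nonneg hm.le (by linarith)) (Real.one_le_rpow ?_ ?_)
    · rw [one_le_div (by linarith)]
      linarith
    · exact div_nonneg (by linarith) hm.le
  have hDε := mul_le_mul_of_nonneg_right hD (Real.rpow_nonneg hε0.le ((1 + m) / (m - n)))
  have hsum := mul_le_mul_of_nonneg_left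
    (two_rpow_neg_mul_add_rpow_le (a := 1 + n) (by linarith) hh₁ hh₂) hε0.le
  have hh₂ε := mul_le_of_le_one_left (Real.rpow_nonneg hh₂ (1 + n)) hε1
  linarith
end

section
/- Let q > 0, A > 0, B ≥ 0, T > 0, let g : [0,T] → ℝ be continuous and nonnegative, and let E : [0,T] → ℝ be differentiable with E(t) > 0 for all t, E′(t) ≥ g(t)·(A·E(t)^{1+q} − B) on [0,T], and A·E(0)^{1+q} > B. Then E(t) ≥ E(0) for all t ∈ [0,T], and ∫₀ᵀ g(s) ds < [q·E(0)^{q}·(A − B·E(0)^{−(1+q)})]^{−1}. -/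
open intervalIntegral Set

/-- A function whose right derivative is nonnegative wherever its value lies strictly between `c`
and its initial value `f a` (with `c < f a`) never drops below `f a`. -/
theorem image_left_le_of_deriv_right_nonneg_of_lt {f f' : ℝ → ℝ} {a b c : ℝ}
    (hf : ContinuousOn f (Icc a b))
    (hf' : ∀ x ∈ Ico a b, HasDerivWithinAt f (f' x) (Ici x) x)
    (hc : c < f a) (hnonneg : ∀ x ∈ Ico a b, c < f x → f x < f a → 0 ≤ f' x)
    {x : ℝ} (hx : x ∈ Icc a b) : f a ≤ f x := by
  have key : ∀ ε > 0, ε * (1 + (b - a)) < f a - c → f a - ε * (1 + (x - a)) ≤ f x := by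
    intro ε hε hεc
    have h := image_le_of_deriv_right_lt_deriv_boundary' (f := fun t => -f t)
      (f' := fun t => -f' t) (B := fun t => -f a + ε * (1 + (t - a))) (B' := fun _ => ε)
      hf.neg (fun t ht => (hf' t ht).neg) (by simpa using hε.le) (by fun_prop)
      (fun t _ => by
        simpa using (((hasDerivWithinAt_id t (Ici t)).sub_const a).const_add 1).const_mul ε
          |>.const_add (-f a))
      (fun t ht heq => by
        have h1 : 0 < ε * (1 + (t - a)) := mul_pos hε (by linarith [ht.1])
        have h2 : ε * (1 + (t - a)) ≤ ε * (1 + (b - a)) := by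
          gcongr
          exact ht.2.le
        have := hnonneg t ht (by linarith) (by linarith)
        linarith) hx
    linarith
  have hab : a ≤ b := hx.1.trans hx.2
  by_contra! hlt
  have hL : 0 < 1 + (b - a) := by linarith
  obtain ⟨δ, hδ, hδ'⟩ := exists_between (lt_min (sub_pos.2 hc) (sub_pos.2 hlt))
  have hmul : δ / (1 + (b - a)) * (1 + (b - a)) = δ := div_mul_cancel₀ _ hL.ne'
  have h1 := key (δ / (1 + (b - a))) (by positivity) (by
    rw [hmul]
    exact hδ'.trans_le (min_le_left _ _))
  have h2 : δ / (1 + (b - a)) * (1 + (x - a)) ≤ δ / (1 + (b - a)) * (1 + (b - a)) := by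
    gcongr
    exact hx.2
  linarith [hδ'.trans_le (min_le_right _ _)]

/-- Deterministic comparison for `E' ≥ g·(A·E^(1+q) − B)` with `A·E(0)^(1+q) > B`:
`E` stays above `E(0)` and `∫₀ᵀ g < [q·E(0)^q·(A − B·E(0)^(−(1+q)))]⁻¹`. -/
theorem stmt_5 (q A B T : ℝ) (hq : 0 < q) (hA : 0 < A) (hB : 0 ≤ B) (hT : 0 < T)
    (g : ℝ → ℝ) (hg_cont : ContinuousOn g (Icc 0 T)) (hg_nonneg : ∀ t ∈ Icc (0 : ℝ) T, 0 ≤ g t)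
    (E E' : ℝ → ℝ) (hE_pos : ∀ t ∈ Icc (0 : ℝ) T, 0 < E t)
    (hE_deriv : ∀ t ∈ Icc (0 : ℝ) T, HasDerivWithinAt E (E' t) (Icc 0 T) t)
    (hE_ineq : ∀ t ∈ Icc (0 : ℝ) T, g t * (A * E t ^ (1 + q) - B) ≤ E' t)
    (h0 : B < A * E 0 ^ (1 + q)) :
    (∀ t ∈ Icc (0 : ℝ) T, E 0 ≤ E t) ∧
      ∫ s in (0 : ℝ)..T, g s < (q * E 0 ^ q * (A - B * E 0 ^ (-(1 + q))))⁻¹ := by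
  have hcont : ContinuousOn E (Icc 0 T) := fun t ht => (hE_deriv t ht).continuousWithinAt
  have hE0 : 0 < E 0 := hE_pos 0 ⟨le_rfl, hT.le⟩
  have hmono : ∀ t ∈ Icc (0 : ℝ) T, E 0 ≤ E t := by
    obtain ⟨c, hc0, hc, hcB⟩ : ∃ c, 0 < c ∧ c < E 0 ∧ B < A * c ^ (1 + q) := by
      have hev : ∀ᶠ c in nhds (E 0), B < A * c ^ (1 + q) :=
        ((Real.continuousAt_rpow_const _ _ (Or.inl hE0.ne')).const_mul A).eventually_const_lt h0
      obtain ⟨c, ⟨hcB, hc0⟩, hc⟩ := (((hev.and (lt_mem_nhds hE0)).filter_mono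
        nhdsWithin_le_nhds).and (self_mem_nhdsWithin (s := Iio (E 0)))).exists
      exact ⟨c, hc0, hc, hcB⟩
    intro t ht
    refine image_left_le_of_deriv_right_nonneg_of_lt (f' := E') hcont (fun x hx => ?_) hc
      (fun x hx hcx _ => ?_) ht
    · exact (hE_deriv x (Ico_subset_Icc_self hx)).mono_of_mem_nhdsWithin
        (Icc_mem_nhdsGE_of_mem hx)
    · have hx' := Ico_subset_Icc_self hx
      refine (mul_nonneg (hg_nonneg x hx') (sub_nonneg.2 ?_)).trans (hE_ineq x hx')
      refine hcB.le.trans ?_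
      gcongr
  refine ⟨hmono, ?_⟩
  set k := A - B * E 0 ^ (-(1 + q)) with hk
  have hinv : E 0 ^ (-(1 + q)) * E 0 ^ (1 + q) = 1 := by
    rw [← Real.rpow_add hE0, neg_add_cancel, Real.rpow_zero]
  have hkpos : 0 < k := by
    have hp : 0 < E 0 ^ (1 + q) := by positivity
    refine pos_of_mul_pos_left ?_ hp.le
    calc 0 < A * E 0 ^ (1 + q) - B := sub_pos.2 h0
      _ = k * E 0 ^ (1 + q) := by rw [hk, sub_mul, mul_assoc B, hinv, mul_one]
  have hderiv : ∀ t ∈ Icc (0 : ℝ) T, q * k * g t ≤ q * E t ^ (-(1 + q)) * E' t := by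
    intro t ht
    have hEt := hE_pos t ht
    have hinvt : E t ^ (1 + q) * E t ^ (-(1 + q)) = 1 := by
      rw [← Real.rpow_add hEt, add_neg_cancel, Real.rpow_zero]
    have hle : E t ^ (-(1 + q)) ≤ E 0 ^ (-(1 + q)) :=
      Real.rpow_le_rpow_of_nonpos hE0 (hmono t ht) (by linarith)
    have hgt := hg_nonneg t ht
    calc q * k * g t ≤ q * (A - B * E t ^ (-(1 + q))) * g t := by
          rw [hk]
          gcongr
      _ = q * E t ^ (-(1 + q)) * (g t * (A * E t ^ (1 + q) - B)) := by
          linear_combination (-q * A * g t) * hinvt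
      _ ≤ q * E t ^ (-(1 + q)) * E' t := by
          gcongr
          exact hE_ineq t ht
  have hintegral : ∫ s in (0 : ℝ)..T, q * k * g s ≤ -E T ^ (-q) - -E 0 ^ (-q) := by
    refine integral_le_sub_of_hasDeriv_right_of_le (g := fun t => -E t ^ (-q))
      (g' := fun t => q * E t ^ (-(1 + q)) * E' t) hT.le ?_ (fun t ht => ?_) ?_
      (fun t ht => hderiv t (Ioo_subset_Icc_self ht))
    · exact (hcont.rpow_const fun t ht => Or.inl (hE_pos t ht).ne').neg
    · have hd := (hE_deriv t (Ioo_subset_Icc_self ht)).hasDerivAt (Icc_mem_nhds ht.1 ht.2)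
      refine (hd.rpow_const (p := -q)
        (Or.inl (hE_pos t (Ioo_subset_Icc_self ht)).ne')).neg.hasDerivWithinAt.congr_deriv ?_
      rw [show -(1 + q) = -q - 1 by ring]
      ring
    · exact (hg_cont.const_mul (q * k)).integrableOn_Icc
  rw [integral_const_mul] at hintegral
  have hTpos : 0 < E T ^ (-q) := Real.rpow_pos_of_pos (hE_pos T ⟨hT.le, le_rfl⟩) _
  have hlt : q * k * ∫ s in (0 : ℝ)..T, g s < (E 0 ^ q)⁻¹ := by
    rw [← Real.rpow_neg hE0.le]
    linarith
  have hp : 0 < E 0 ^ q := by positivity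
  rw [← one_div, lt_div_iff₀ (by positivity)]
  rw [← one_div, lt_div_iff₀ hp] at hlt
  linarith
end

section
/- Let m > 0, ρ ∈ ℝ, T > 0, let w : [0,T] → ℝ be continuous, and let h₁, h₂ : [0,T] → ℝ be differentiable with h₁(t), h₂(t) > 0 for all t and h₁′(t) = e^{ρ w(t)}·(h₁(t)^{1+m} + h₂(t)^{1+m}) and h₂′(t) = e^{ρ w(t)}·(h₁(t)^{1+m} + h₂(t)^{1+m}) on [0,T]. Then ∫₀ᵀ e^{ρ w(s)} ds < 2^{m}·m^{−1}·(h₁(0) + h₂(0))^{−m}. -/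
open intervalIntegral Set Real

/-- Power-mean inequality for two nonnegative reals. -/
theorem rpow_add_le_mul_rpow_add_rpow_of_nonneg {x y p : ℝ} (hx : 0 ≤ x) (hy : 0 ≤ y)
    (hp : 1 ≤ p) : (x + y) ^ p ≤ 2 ^ (p - 1) * (x ^ p + y ^ p) := by
  lift x to NNReal using hx
  lift y to NNReal using hy
  exact_mod_cast NNReal.rpow_add_le_mul_rpow_add_rpow x y hp

/-- Pathwise content of Theorem 4.1, Case 1: for the comparison system with equal exponents
`m = n = p = q` and `ρ₁ = ρ₂ = ρ`, existence of a positive solution on `[0,T]` forces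
`∫₀ᵀ e^{ρ w(s)} ds < 2^m·m⁻¹·(h₁(0)+h₂(0))^(−m)`. -/
theorem stmt_6 (m ρ T : ℝ) (hm : 0 < m) (hT : 0 < T)
    (w : ℝ → ℝ) (hw : ContinuousOn w (Icc 0 T))
    (h₁ h₂ : ℝ → ℝ)
    (h₁_pos : ∀ t ∈ Icc (0 : ℝ) T, 0 < h₁ t) (h₂_pos : ∀ t ∈ Icc (0 : ℝ) T, 0 < h₂ t)
    (h₁_deriv : ∀ t ∈ Icc (0 : ℝ) T,
      HasDerivWithinAt h₁ (Real.exp (ρ * w t) * (h₁ t ^ (1 + m) + h₂ t ^ (1 + m))) (Icc 0 T) t)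
    (h₂_deriv : ∀ t ∈ Icc (0 : ℝ) T,
      HasDerivWithinAt h₂ (Real.exp (ρ * w t) * (h₁ t ^ (1 + m) + h₂ t ^ (1 + m))) (Icc 0 T) t) :
    ∫ s in (0 : ℝ)..T, Real.exp (ρ * w s)
      < 2 ^ m * m⁻¹ * (h₁ 0 + h₂ 0) ^ (-m) := by
  have sum_pos : ∀ t ∈ Icc (0 : ℝ) T, 0 < h₁ t + h₂ t := fun t ht =>
    add_pos (h₁_pos t ht) (h₂_pos t ht)
  have h_deriv : ∀ t ∈ Icc (0 : ℝ) T,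
      HasDerivWithinAt (fun s => -(2 ^ m * m⁻¹ * (h₁ s + h₂ s) ^ (-m)))
        (2 ^ m * (h₁ t + h₂ t) ^ (-m - 1) *
          (2 * (Real.exp (ρ * w t) * (h₁ t ^ (1 + m) + h₂ t ^ (1 + m))))) (Icc 0 T) t := by
    intro t ht
    refine ((((h₁_deriv t ht).add (h₂_deriv t ht)).rpow_const (p := -m)
      (Or.inl (sum_pos t ht).ne')).const_mul (2 ^ m * m⁻¹)).neg.congr_deriv ?_
    simp only [Pi.add_apply]
    field_simp
    ring
  have h_le : ∀ t ∈ Ioo (0 : ℝ) T, Real.exp (ρ * w t) ≤ 2 ^ m * (h₁ t + h₂ t) ^ (-m - 1) *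
      (2 * (Real.exp (ρ * w t) * (h₁ t ^ (1 + m) + h₂ t ^ (1 + m)))) := by
    intro t ht
    have ht' := Ioo_subset_Icc_self ht
    have mean := rpow_add_le_mul_rpow_add_rpow_of_nonneg (h₁_pos t ht').le (h₂_pos t ht').le
      (show 1 ≤ 1 + m by linarith)
    rw [add_sub_cancel_left] at mean
    have cancel : (h₁ t + h₂ t) ^ (-m - 1) * (h₁ t + h₂ t) ^ (1 + m) = 1 := by
      rw [← Real.rpow_add (sum_pos t ht')]
      ring_nf
      exact Real.rpow_zero _
    have one_le := mul_le_mul_of_nonneg_left mean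
      (Real.rpow_nonneg (sum_pos t ht').le (-m - 1))
    rw [cancel] at one_le
    nlinarith [mul_le_mul_of_nonneg_left one_le (Real.exp_pos (ρ * w t)).le,
      Real.exp_pos (ρ * w t)]
  have bound := integral_le_sub_of_hasDeriv_right_of_le hT.le
    (fun t ht => (h_deriv t ht).continuousWithinAt)
    (fun t ht => ((h_deriv t (Ioo_subset_Icc_self ht)).hasDerivAt
      (Icc_mem_nhds ht.1 ht.2)).hasDerivWithinAt)
    (φ := fun s => Real.exp (ρ * w s))
    (ContinuousOn.integrableOn_Icc (by fun_prop)) h_le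
  have final_pos : 0 < 2 ^ m * m⁻¹ * (h₁ T + h₂ T) ^ (-m) := by
    have := Real.rpow_pos_of_pos (sum_pos T (right_mem_Icc.2 hT.le)) (-m)
    positivity
  linarith
end

section
/- Let β > 0, μ ≥ 0, T > 0, let g : [0,T] → ℝ be continuous and nonnegative, and let E : [0,T] → ℝ be differentiable with E(t) > 0 for all t and E′(t) ≥ −μ·E(t) + 2^{−β}·g(t)·E(t)^{1+β} on [0,T]. Then ∫₀ᵀ g(s)·e^{−μ β s} ds < 2^{β}·β^{−1}·E(0)^{−β}. -/
open intervalIntegral Set Real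

/-- Pathwise comparison underlying Theorem 6.1, Case 1: if `E > 0` solves the damped
inequality `E' ≥ −μE + 2^{−β} g E^{1+β}` on `[0,T]`, then
`∫₀ᵀ g(s)e^{−μβs} ds < 2^β·β⁻¹·E(0)^{−β}`. -/
theorem stmt_12 (β μ T : ℝ) (hβ : 0 < β) (hμ : 0 ≤ μ) (hT : 0 < T)
    (g : ℝ → ℝ) (hg_cont : ContinuousOn g (Icc 0 T)) (hg_nonneg : ∀ t ∈ Icc (0 : ℝ) T, 0 ≤ g t)
    (E E' : ℝ → ℝ) (hE_pos : ∀ t ∈ Icc (0 : ℝ) T, 0 < E t)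
    (hE_deriv : ∀ t ∈ Icc (0 : ℝ) T, HasDerivWithinAt E (E' t) (Icc 0 T) t)
    (hE_ineq : ∀ t ∈ Icc (0 : ℝ) T,
      -μ * E t + 2 ^ (-β) * g t * E t ^ (1 + β) ≤ E' t) :
    ∫ s in (0 : ℝ)..T, g s * Real.exp (-(μ * β * s))
      < 2 ^ β * β⁻¹ * E 0 ^ (-β) := by
  have hc : 0 < (2 : ℝ) ^ β * β⁻¹ := by positivity
  let H : ℝ → ℝ := fun t => E t ^ (-β) * exp (-(μ * β * t))
  have hH : ∀ t ∈ Icc (0 : ℝ) T, HasDerivWithinAt (fun t => -(2 ^ β * β⁻¹) * H t)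
      (-(2 ^ β * β⁻¹) * (E' t * -β * E t ^ (-β - 1) * exp (-(μ * β * t)) +
        E t ^ (-β) * (exp (-(μ * β * t)) * -(μ * β)))) (Icc 0 T) t := by
    intro t ht
    have hexp : HasDerivAt (fun t : ℝ => exp (-(μ * β * t)))
        (exp (-(μ * β * t)) * -(μ * β)) t := by
      simpa using ((hasDerivAt_id t).const_mul (μ * β)).neg.exp
    exact (((hE_deriv t ht).rpow_const (Or.inl (hE_pos t ht).ne')).mul
      hexp.hasDerivWithinAt).const_mul _
  have hφ_cont : ContinuousOn (fun s => g s * exp (-(μ * β * s))) (Icc 0 T) := by fun_prop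
  have hle := integral_le_sub_of_hasDeriv_right_of_le hT.le
    (fun t ht => (hH t ht).continuousWithinAt)
    (fun t ht => ((hH t (Ioo_subset_Icc_self ht)).hasDerivAt
      (Icc_mem_nhds ht.1 ht.2)).hasDerivWithinAt)
    hφ_cont.integrableOn_Icc ?_
  · have hT_pos : 0 < 2 ^ β * β⁻¹ * H T :=
      mul_pos hc (mul_pos (rpow_pos_of_pos (hE_pos T ⟨hT.le, le_rfl⟩) _) (exp_pos _))
    have h0 : H 0 = E 0 ^ (-β) := by simp [H]
    rw [h0] at hle
    linarith
  · intro t ht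
    have hineq := hE_ineq t (Ioo_subset_Icc_self ht)
    have hpos := hE_pos t (Ioo_subset_Icc_self ht)
    have h1 : E t ^ (-β - 1) * E t = E t ^ (-β) := by
      rw [← rpow_add_one hpos.ne', sub_add_cancel]
    have h2 : E t ^ (-β - 1) * E t ^ (1 + β) = 1 := by
      rw [← rpow_add hpos, show -β - 1 + (1 + β) = 0 by ring, rpow_zero]
    have h3 : (2 : ℝ) ^ β * 2 ^ (-β) = 1 := by
      rw [← rpow_add two_pos, add_neg_cancel, rpow_zero]
    calc g t * exp (-(μ * β * t))
        = 2 ^ β * E t ^ (-β - 1) * exp (-(μ * β * t)) *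
            (-μ * E t + 2 ^ (-β) * g t * E t ^ (1 + β)) +
            2 ^ β * μ * E t ^ (-β) * exp (-(μ * β * t)) := by
          linear_combination (-(2 ^ β * 2 ^ (-β)) * g t * exp (-(μ * β * t))) * h2 -
            g t * exp (-(μ * β * t)) * h3 + 2 ^ β * μ * exp (-(μ * β * t)) * h1
      _ ≤ 2 ^ β * E t ^ (-β - 1) * exp (-(μ * β * t)) * E' t +
            2 ^ β * μ * E t ^ (-β) * exp (-(μ * β * t)) := by gcongr
      _ = _ := by field_simp; ring
end

section
/- Let m > 0, ρ ∈ ℝ, T > 0, let w₁, w₂ : [0,T] → ℝ be continuous, let C₁₁, C₁₂, C₂₁, C₂₂ > 0, and set σ₁ = min(C₁₁, C₁₂), σ₂ = min(C₂₁, C₂₂). Let h₁, h₂ : [0,T] → ℝ be differentiable with h₁(t), h₂(t) > 0 for all t, satisfying h₁′(t) = e^{ρ(w₁(t) + w₂(t))}·(C₁₁·h₁(t)^{1+m} + C₁₂·h₂(t)^{1+m}) and h₂′(t) = e^{ρ(w₁(t) + w₂(t))}·(C₂₁·h₁(t)^{1+m} + C₂₂·h₂(t)^{1+m}) on [0,T].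 Then ∫₀ᵀ e^{ρ(w₁(s) + w₂(s))} ds < 2^{1+m}·(m·(σ₁ + σ₂))^{−1}·(h₁(0) + h₂(0))^{−m}. -/
open intervalIntegral Set Real

/-- A crude power-mean bound: the larger of two numbers is at least their average. -/
theorem rpow_half_add_le {a b p : ℝ} (ha : 0 ≤ a) (hb : 0 ≤ b) (hp : 0 ≤ p) :
    ((a + b) / 2) ^ p ≤ a ^ p + b ^ p := by
  rcases le_total a b with hab | hab
  · have h := rpow_le_rpow (by positivity) (by linarith : (a + b) / 2 ≤ b) hp
    linarith [rpow_nonneg ha p]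
  · have h := rpow_le_rpow (by positivity) (by linarith : (a + b) / 2 ≤ a) hp
    linarith [rpow_nonneg hb p]

/-- A weighted sum of two nonnegative powers dominates the smaller weight times the power of the
average. -/
theorem min_mul_rpow_half_add_le {a b p c d : ℝ} (ha : 0 ≤ a) (hb : 0 ≤ b) (hp : 0 ≤ p)
    (hc : 0 ≤ c) (hd : 0 ≤ d) :
    min c d * ((a + b) / 2) ^ p ≤ c * a ^ p + d * b ^ p :=
  calc min c d * ((a + b) / 2) ^ p ≤ min c d * (a ^ p + b ^ p) :=
        mul_le_mul_of_nonneg_left (rpow_half_add_le ha hb hp) (le_min hc hd)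
    _ = min c d * a ^ p + min c d * b ^ p := mul_add _ _ _
    _ ≤ c * a ^ p + d * b ^ p :=
        add_le_add (mul_le_mul_of_nonneg_right (min_le_left c d) (rpow_nonneg ha p))
          (mul_le_mul_of_nonneg_right (min_le_right c d) (rpow_nonneg hb p))

/-- A positive supersolution of `E' = g * E ^ (1 + m)` on `[0, T]` bounds the integral of `g`. -/
theorem mul_integral_lt_rpow_neg {m T : ℝ} (hm : 0 < m) (hT : 0 ≤ T) {g E E' : ℝ → ℝ}
    (hg : ContinuousOn g (Icc 0 T)) (hE : ∀ t ∈ Icc (0 : ℝ) T, 0 < E t)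
    (hderiv : ∀ t ∈ Icc (0 : ℝ) T, HasDerivWithinAt E (E' t) (Icc 0 T) t)
    (hle : ∀ t ∈ Icc (0 : ℝ) T, g t * E t ^ (1 + m) ≤ E' t) :
    m * ∫ s in (0 : ℝ)..T, g s < E 0 ^ (-m) := by
  have hF : ∀ t ∈ Icc (0 : ℝ) T, HasDerivWithinAt (fun s => -E s ^ (-m))
      (-(E' t * -m * E t ^ (-m - 1))) (Icc 0 T) t := fun t ht =>
    ((hderiv t ht).rpow_const (Or.inl (hE t ht).ne')).neg
  have key := integral_le_sub_of_hasDeriv_right_of_le hT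
    (fun t ht => (hF t ht).continuousWithinAt)
    (fun t ht => ((hF t (Ioo_subset_Icc_self ht)).hasDerivAt
      (Icc_mem_nhds ht.1 ht.2)).hasDerivWithinAt)
    ((hg.const_mul m).integrableOn_Icc) (fun t ht => by
      have ht' := Ioo_subset_Icc_self ht
      have hpow : E t ^ (1 + m) * E t ^ (-m - 1) = 1 := by
        rw [← rpow_add (hE t ht'), show 1 + m + (-m - 1) = 0 by ring, rpow_zero]
      have hpos := rpow_pos_of_pos (hE t ht') (-m - 1)
      calc m * g t = m * (g t * E t ^ (1 + m)) * E t ^ (-m - 1) := by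
            linear_combination (-(m * g t)) * hpow
        _ ≤ m * E' t * E t ^ (-m - 1) := by gcongr; exact hle t ht'
        _ = -(E' t * -m * E t ^ (-m - 1)) := by ring)
  rw [intervalIntegral.integral_const_mul] at key
  have := rpow_pos_of_pos (hE T (right_mem_Icc.2 hT)) (-m)
  linarith

/-- Pathwise content of Theorem 7.2, Case 1 (two-dimensional noise, equal exponents):
a positive solution of the comparison system on `[0,T]` forces
`∫₀ᵀ e^{ρ(w₁(s)+w₂(s))} ds < 2^{1+m}·(m(σ₁+σ₂))⁻¹·(h₁(0)+h₂(0))^{−m}`. -/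
theorem stmt_16 (m ρ T : ℝ) (hm : 0 < m) (hT : 0 < T)
    (w₁ w₂ : ℝ → ℝ) (hw₁ : ContinuousOn w₁ (Icc 0 T)) (hw₂ : ContinuousOn w₂ (Icc 0 T))
    (C₁₁ C₁₂ C₂₁ C₂₂ : ℝ) (hC₁₁ : 0 < C₁₁) (hC₁₂ : 0 < C₁₂) (hC₂₁ : 0 < C₂₁) (hC₂₂ : 0 < C₂₂)
    (σ₁ σ₂ : ℝ) (hσ₁ : σ₁ = min C₁₁ C₁₂) (hσ₂ : σ₂ = min C₂₁ C₂₂)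
    (h₁ h₂ : ℝ → ℝ)
    (h₁_pos : ∀ t ∈ Icc (0 : ℝ) T, 0 < h₁ t) (h₂_pos : ∀ t ∈ Icc (0 : ℝ) T, 0 < h₂ t)
    (h₁_deriv : ∀ t ∈ Icc (0 : ℝ) T,
      HasDerivWithinAt h₁
        (Real.exp (ρ * (w₁ t + w₂ t)) * (C₁₁ * h₁ t ^ (1 + m) + C₁₂ * h₂ t ^ (1 + m)))
        (Icc 0 T) t)
    (h₂_deriv : ∀ t ∈ Icc (0 : ℝ) T,
      HasDerivWithinAt h₂
        (Real.exp (ρ * (w₁ t + w₂ t)) * (C₂₁ * h₁ t ^ (1 + m) + C₂₂ * h₂ t ^ (1 + m)))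
        (Icc 0 T) t) :
    ∫ s in (0 : ℝ)..T, Real.exp (ρ * (w₁ s + w₂ s))
      < 2 ^ (1 + m) * (m * (σ₁ + σ₂))⁻¹ * (h₁ 0 + h₂ 0) ^ (-m) := by
  have hσ₁pos : 0 < σ₁ := hσ₁ ▸ lt_min hC₁₁ hC₁₂
  have hσ₂pos : 0 < σ₂ := hσ₂ ▸ lt_min hC₂₁ hC₂₂
  have hg : ContinuousOn (fun s => Real.exp (ρ * (w₁ s + w₂ s))) (Icc 0 T) :=
    ((hw₁.add hw₂).const_mul ρ).rexp
  have key := mul_integral_lt_rpow_neg hm hT.le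
    (hg.const_mul ((σ₁ + σ₂) / 2 ^ (1 + m)))
    (fun t ht => add_pos (h₁_pos t ht) (h₂_pos t ht))
    (fun t ht => (h₁_deriv t ht).add (h₂_deriv t ht)) (fun t ht => by
      have ha := (h₁_pos t ht).le
      have hb := (h₂_pos t ht).le
      have hp : 0 ≤ 1 + m := by linarith
      have h1 := min_mul_rpow_half_add_le ha hb hp hC₁₁.le hC₁₂.le
      have h2 := min_mul_rpow_half_add_le ha hb hp hC₂₁.le hC₂₂.le
      rw [← hσ₁] at h1
      rw [← hσ₂] at h2
      rw [← mul_add]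
      calc _ = Real.exp (ρ * (w₁ t + w₂ t)) *
              (σ₁ * ((h₁ t + h₂ t) / 2) ^ (1 + m) + σ₂ * ((h₁ t + h₂ t) / 2) ^ (1 + m)) := by
            rw [div_rpow (by positivity) zero_le_two]
            ring
        _ ≤ _ := by gcongr)
  rw [intervalIntegral.integral_const_mul] at key
  have hk : 0 < 2 ^ (1 + m) * (m * (σ₁ + σ₂))⁻¹ := by positivity
  calc ∫ s in (0 : ℝ)..T, Real.exp (ρ * (w₁ s + w₂ s))
      = 2 ^ (1 + m) * (m * (σ₁ + σ₂))⁻¹ * (m * ((σ₁ + σ₂) / 2 ^ (1 + m) *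
          ∫ s in (0 : ℝ)..T, Real.exp (ρ * (w₁ s + w₂ s)))) := by
        have : (2 : ℝ) ^ (1 + m) ≠ 0 := by positivity
        field_simp
    _ < _ := mul_lt_mul_of_pos_left key hk
end

section
/- Let m > 0, a₁, a₂, a₃, a₄ ∈ ℝ, T > 0, let w : [0,T] → ℝ be continuous, and let h₁, h₂ : [0,T] → ℝ be differentiable with h₁(t), h₂(t) > 0 for all t, satisfying h₁′(t) = e^{a₁ w(t)}·h₁(t)^{1+m} + e^{a₂ w(t)}·h₂(t)^{1+m} and h₂′(t) = e^{a₃ w(t)}·h₁(t)^{1+m} + e^{a₄ w(t)}·h₂(t)^{1+m} on [0,T]. Then ∫₀ᵀ min(e^{a₁ w(s)}, e^{a₂ w(s)}, e^{a₃ w(s)}, e^{a₄ w(s)}) ds < 2^{m}·m^{−1}·(h₁(0) + h₂(0))^{−m}. -/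
open intervalIntegral Set Real

/-- A positive function satisfying `φ · E ^ (1 + m) ≤ E'` on `[a, b]` forces the integral of `φ`
to stay strictly below `m⁻¹ · E(a) ^ (-m)`. -/
theorem integral_lt_of_mul_rpow_le_deriv {m a b : ℝ} (hm : 0 < m) (hab : a ≤ b)
    {φ E E' : ℝ → ℝ} (hφ : ContinuousOn φ (Icc a b)) (hE : ∀ t ∈ Icc a b, 0 < E t)
    (hE' : ∀ t ∈ Icc a b, HasDerivWithinAt E (E' t) (Icc a b) t)
    (hle : ∀ t ∈ Icc a b, φ t * E t ^ (1 + m) ≤ E' t) :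
    ∫ t in a..b, φ t < m⁻¹ * E a ^ (-m) := by
  have hg : ∀ t ∈ Icc a b, HasDerivWithinAt (fun s => -m⁻¹ * E s ^ (-m))
      (-m⁻¹ * (E' t * -m * E t ^ (-m - 1))) (Icc a b) t := fun t ht =>
    ((hE' t ht).rpow_const (Or.inl (hE t ht).ne')).const_mul _
  have key := integral_le_sub_of_hasDeriv_right_of_le hab
    (fun t ht => (hg t ht).continuousWithinAt)
    (fun t ht => ((hg t (Ioo_subset_Icc_self ht)).hasDerivAt
      (Icc_mem_nhds ht.1 ht.2)).hasDerivWithinAt)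
    hφ.integrableOn_Icc (fun t ht => by
      have ht' := Ioo_subset_Icc_self ht
      have hpos := Real.rpow_pos_of_pos (hE t ht') (-m - 1)
      have hone : E t ^ (1 + m) * E t ^ (-m - 1) = 1 := by
        rw [← Real.rpow_add (hE t ht')]
        ring_nf
        exact Real.rpow_zero _
      calc φ t = φ t * E t ^ (1 + m) * E t ^ (-m - 1) := by rw [mul_assoc, hone, mul_one]
        _ ≤ E' t * E t ^ (-m - 1) := mul_le_mul_of_nonneg_right (hle t ht') hpos.le
        _ = -m⁻¹ * (E' t * -m * E t ^ (-m - 1)) := by field_simp)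
  have hb : 0 < m⁻¹ * E b ^ (-m) :=
    mul_pos (inv_pos.2 hm) (Real.rpow_pos_of_pos (hE b (right_mem_Icc.2 hab)) _)
  linarith

/-- The power mean inequality `(x + y) ^ (1 + m) ≤ 2 ^ m * (x ^ (1 + m) + y ^ (1 + m))`. -/
theorem add_rpow_one_add_le {m x y : ℝ} (hm : 0 ≤ m) (hx : 0 ≤ x) (hy : 0 ≤ y) :
    (x + y) ^ (1 + m) ≤ 2 ^ m * (x ^ (1 + m) + y ^ (1 + m)) := by
  lift x to NNReal using hx
  lift y to NNReal using hy
  have h := NNReal.rpow_add_le_mul_rpow_add_rpow x y (p := 1 + m) (by linarith)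
  rw [add_sub_cancel_left] at h
  exact_mod_cast h

/-- Pathwise content of Theorem 5.2, Case 1 (general noise coefficients, equal exponents):
a positive solution of the comparison system (5.2) on `[0,T]` forces the integral of the
minimum of the four exponentials to stay below `2^m·m⁻¹·(h₁(0)+h₂(0))^{−m}`. -/
theorem stmt_17 (m a₁ a₂ a₃ a₄ T : ℝ) (hm : 0 < m) (hT : 0 < T)
    (w : ℝ → ℝ) (hw : ContinuousOn w (Icc 0 T))
    (h₁ h₂ : ℝ → ℝ)
    (h₁_pos : ∀ t ∈ Icc (0 : ℝ) T, 0 < h₁ t) (h₂_pos : ∀ t ∈ Icc (0 : ℝ) T, 0 < h₂ t)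
    (h₁_deriv : ∀ t ∈ Icc (0 : ℝ) T,
      HasDerivWithinAt h₁
        (Real.exp (a₁ * w t) * h₁ t ^ (1 + m) + Real.exp (a₂ * w t) * h₂ t ^ (1 + m))
        (Icc 0 T) t)
    (h₂_deriv : ∀ t ∈ Icc (0 : ℝ) T,
      HasDerivWithinAt h₂
        (Real.exp (a₃ * w t) * h₁ t ^ (1 + m) + Real.exp (a₄ * w t) * h₂ t ^ (1 + m))
        (Icc 0 T) t) :
    ∫ s in (0 : ℝ)..T,
        min (min (Real.exp (a₁ * w s)) (Real.exp (a₂ * w s)))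
          (min (Real.exp (a₃ * w s)) (Real.exp (a₄ * w s)))
      < 2 ^ m * m⁻¹ * (h₁ 0 + h₂ 0) ^ (-m) := by
  set μ : ℝ → ℝ := fun s =>
    min (min (Real.exp (a₁ * w s)) (Real.exp (a₂ * w s)))
      (min (Real.exp (a₃ * w s)) (Real.exp (a₄ * w s))) with hμ
  have hμc : ContinuousOn μ (Icc 0 T) := by fun_prop
  have h2 : (0 : ℝ) < 2 ^ m := Real.rpow_pos_of_pos two_pos m
  have key := integral_lt_of_mul_rpow_le_deriv (φ := fun s => (2 ^ m)⁻¹ * μ s)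
    (E := fun s => h₁ s + h₂ s) hm hT.le (hμc.const_mul _)
    (fun t ht => add_pos (h₁_pos t ht) (h₂_pos t ht))
    (fun t ht => (h₁_deriv t ht).add (h₂_deriv t ht)) (fun t ht => by
      have hx := Real.rpow_pos_of_pos (h₁_pos t ht) (1 + m)
      have hy := Real.rpow_pos_of_pos (h₂_pos t ht) (1 + m)
      have hμ0 : 0 ≤ μ t := by simp only [hμ]; positivity
      have hμ₁ : μ t ≤ Real.exp (a₁ * w t) := (min_le_left _ _).trans (min_le_left _ _)
      have hμ₂ : μ t ≤ Real.exp (a₂ * w t) := (min_le_left _ _).trans (min_le_right _ _)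
      calc (2 ^ m)⁻¹ * μ t * (h₁ t + h₂ t) ^ (1 + m)
          ≤ (2 ^ m)⁻¹ * μ t * (2 ^ m * (h₁ t ^ (1 + m) + h₂ t ^ (1 + m))) := by
            gcongr
            exact add_rpow_one_add_le hm.le (h₁_pos t ht).le (h₂_pos t ht).le
        _ = μ t * h₁ t ^ (1 + m) + μ t * h₂ t ^ (1 + m) := by field_simp
        _ ≤ Real.exp (a₁ * w t) * h₁ t ^ (1 + m) + Real.exp (a₂ * w t) * h₂ t ^ (1 + m) := by
            gcongr
        _ ≤ _ := le_add_of_nonneg_right (by positivity))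
  rw [intervalIntegral.integral_const_mul, inv_mul_lt_iff₀ h2] at key
  rwa [mul_assoc]
end
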